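/- Let n ≥ 1 and let F ∈ ℝ[X₁, …, Xₙ] be a polynomial that vanishes on a nonempty subset U of the hyperplane H = {x ∈ ℝⁿ : x₁ + ⋯ + xₙ = 0} which is open in the subspace topology of H. Then the polynomial X₁ + ⋯ + Xₙ divides F in ℝ[X₁, …, Xₙ]. -/

import Mathlib

namespace MvPolynomial

theorem eq_zero_of_eval_eq_zero_of_isOpen {σ : Type*} [Finite σ] {p : MvPolynomial σ ℝ}
    {V : Set (σ → ℝ)} (hV : IsOpen V) (hne : V.Nonempty) (h : ∀ x ∈ V, eval x p = 0) :
    p = 0 := by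
  have := Fintype.ofFinite σ
  obtain ⟨x, hx⟩ := hne
  obtain ⟨ε, hε, hball⟩ := Metric.isOpen_iff.1 hV x hx
  rw [ball_pi x hε] at hball
  refine funext_set (fun i => Metric.ball (x i) ε) (fun i => ?_) fun y hy => ?_
  · rw [Real.ball_eq_Ioo]
    exact Set.Ioo_infinite (by linarith)
  · rw [h y (hball hy), map_zero]

theorem dvd_sub_aeval {σ R : Type*} [CommRing R] {s : MvPolynomial σ R}
    {g : σ → MvPolynomial σ R} (hg : ∀ i, s ∣ X i - g i) (p : MvPolynomial σ R) :
    s ∣ p - aeval g p := by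
  have key : Ideal.Quotient.mkₐ R (Ideal.span {s}) =
      (Ideal.Quotient.mkₐ R (Ideal.span {s})).comp (aeval g) := by
    ext i
    simpa [Ideal.Quotient.eq, Ideal.mem_span_singleton] using hg i
  rw [← Ideal.mem_span_singleton, ← Ideal.Quotient.eq]
  exact DFunLike.congr_fun key p

end MvPolynomial

/-- If `F ∈ ℝ[X₁, …, Xₙ]` vanishes on a nonempty relatively open subset of the
hyperplane `H = {x : x₁ + ⋯ + xₙ = 0}`, then `X₁ + ⋯ + Xₙ` divides `F`. -/
theorem sum_X_dvd_of_vanish_on_open (n : ℕ) (hn : 1 ≤ n)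
    (F : MvPolynomial (Fin n) ℝ)
    (U : Set {x : Fin n → ℝ // (∑ i, x i) = 0})
    (hUopen : IsOpen U) (hUne : U.Nonempty)
    (hF : ∀ x ∈ U, MvPolynomial.eval (x : {x : Fin n → ℝ // (∑ i, x i) = 0}).val F = 0) :
    (∑ i : Fin n, MvPolynomial.X i : MvPolynomial (Fin n) ℝ) ∣ F := by
  let k : Fin n := ⟨0, hn⟩
  let proj (x : Fin n → ℝ) : {x : Fin n → ℝ // (∑ i, x i) = 0} :=
    ⟨fun i => x i - if i = k then ∑ j, x j else 0, by simp [Finset.sum_sub_distrib]⟩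
  let g (i : Fin n) : MvPolynomial (Fin n) ℝ :=
    MvPolynomial.X i - if i = k then ∑ j, MvPolynomial.X j else 0
  have hproj : Continuous proj := by
    refine Continuous.subtype_mk (continuous_pi fun i => ?_) _
    split_ifs <;> fun_prop
  have hg (x : Fin n → ℝ) :
      MvPolynomial.eval x (MvPolynomial.aeval g F) = MvPolynomial.eval (proj x).val F := by
    rw [← MvPolynomial.coe_aeval_eq_eval, ← MvPolynomial.coe_aeval_eq_eval, RingHom.coe_coe,
      RingHom.coe_coe, ← AlgHom.comp_apply, MvPolynomial.comp_aeval]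
    congr 2
    ext i
    by_cases hi : i = k <;> simp [g, proj, hi]
  have hzero : MvPolynomial.aeval g F = 0 := by
    refine MvPolynomial.eq_zero_of_eval_eq_zero_of_isOpen (hUopen.preimage hproj) ?_
      fun x hx => (hg x).trans (hF _ hx)
    obtain ⟨u, hu⟩ := hUne
    have hfix : proj u.val = u := by
      ext i
      simp [proj, u.property]
    exact ⟨u.val, by rwa [Set.mem_preimage, hfix]⟩
  have hdvd := MvPolynomial.dvd_sub_aeval (s := ∑ i, MvPolynomial.X i) (g := g)
    (fun i => by by_cases hi : i = k <;> simp [g, hi]) F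
  rwa [hzero, sub_zero] at hdvd
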